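/- Let n ≥ 1 and let v ∈ ℝⁿ be nonzero. An n×n real matrix M is symmetric positive semi-definite and satisfies M v = 0 if and only if there exist a matrix B ∈ Matrix n n ℝ and a symmetric positive semi-definite matrix D ∈ Matrix n n ℝ such that M = P⊥_v B D Bᵀ P⊥_v. -/

import Mathlib

open Matrix

/-- The action of a real matrix on a Euclidean vector. -/
noncomputable def mulVecE {m n : ℕ} (A : Matrix (Fin m) (Fin n) ℝ)
    (v : EuclideanSpace ℝ (Fin n)) : EuclideanSpace ℝ (Fin m) :=
  Matrix.toEuclideanLin A v

/-- The orthogonal projector `P⊥_v = I - v vᵀ / ‖v‖²` onto the orthogonal complement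
of the span of `v`. -/
noncomputable def projPerp {n : ℕ} (v : EuclideanSpace ℝ (Fin n)) :
    Matrix (Fin n) (Fin n) ℝ :=
  1 - (‖v‖ ^ 2)⁻¹ • Matrix.vecMulVec (fun i => v i) (fun i => v i)

theorem projPerp_transpose {n : ℕ} (v : EuclideanSpace ℝ (Fin n)) :
    (projPerp v)ᵀ = projPerp v := by
  simp [projPerp, transpose_vecMulVec]

theorem projPerp_mulVec_self {n : ℕ} {v : EuclideanSpace ℝ (Fin n)} (hv : v ≠ 0) :
    projPerp v *ᵥ (fun i => v i) = 0 := by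
  have hdot : (fun i => v i) ⬝ᵥ (fun i => v i) = ‖v‖ ^ 2 := by
    rw [EuclideanSpace.real_norm_sq_eq]
    simp [dotProduct, sq]
  have hnorm : ‖v‖ ^ 2 ≠ 0 := by simpa using hv
  ext i
  simp [projPerp, sub_mulVec, smul_mulVec, vecMulVec_mulVec, hdot]
  field_simp
  simp

theorem mulVecE_eq_zero_iff {m n : ℕ} (A : Matrix (Fin m) (Fin n) ℝ)
    (v : EuclideanSpace ℝ (Fin n)) : mulVecE A v = 0 ↔ A *ᵥ (fun i => v i) = 0 := by
  change WithLp.toLp 2 (A *ᵥ (fun i => v i)) = 0 ↔ _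
  simp

theorem mul_projPerp_of_mulVec_eq_zero {m n : ℕ} {A : Matrix (Fin m) (Fin n) ℝ}
    {v : EuclideanSpace ℝ (Fin n)} (h : A *ᵥ (fun i => v i) = 0) :
    A * projPerp v = A := by
  simp [projPerp, Matrix.mul_sub, mul_vecMulVec, h]

/-- For a nonzero vector `v`, a matrix `M` is symmetric positive semi-definite with
`M v = 0` if and only if `M = P⊥_v B D Bᵀ P⊥_v` for some matrix `B` and some symmetric
positive semi-definite matrix `D`. -/
theorem psd_degenerate_iff_projPerp_conj {n : ℕ} (hn : 1 ≤ n)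
    (v : EuclideanSpace ℝ (Fin n)) (hv : v ≠ 0)
    (M : Matrix (Fin n) (Fin n) ℝ) :
    (M.PosSemidef ∧ mulVecE M v = 0) ↔
      ∃ B D : Matrix (Fin n) (Fin n) ℝ, D.PosSemidef ∧
        M = projPerp v * B * D * Bᵀ * projPerp v := by
  constructor
  · rintro ⟨hM, hMv⟩
    have hMP := mul_projPerp_of_mulVec_eq_zero ((mulVecE_eq_zero_iff M v).1 hMv)
    have hMt : Mᵀ = M := by simpa using hM.isHermitian.eq
    have hPM : projPerp v * M = M := by
      simpa [projPerp_transpose, hMt] using congrArg transpose hMP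
    exact ⟨1, M, hM, by simp [hPM, hMP]⟩
  · rintro ⟨B, D, hD, rfl⟩
    refine ⟨?_, ?_⟩
    · simpa [conjTranspose_eq_transpose_of_trivial, projPerp_transpose, Matrix.mul_assoc]
        using hD.mul_mul_conjTranspose_same (projPerp v * B)
    · rw [mulVecE_eq_zero_iff, ← mulVec_mulVec, projPerp_mulVec_self hv, mulVec_zero]
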